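/- (Diagonal forest-polynomial identity.) Let G be a Feynman graph and let k be an external vertex. Then in the polynomial ring ℤ[α_e : e ∈ E] one has: Σ_{f} α_f · Ψ̃_G^{r(k,w)} = Ψ̃_G · Σ_{f incident to k} α_f − Σ_{ℓ' external, ℓ' ≠ k} Ψ̃_G^{p(k,ℓ')}, where the sum on the left is over edges f with endpoints k and an internal vertex w, and r(k,w) denotes the collection consisting of the part {k,w} together with the singletons {m} for every external vertex m ≠ k. -/

import Mathlib

open scoped Classical ENNReal
open MeasureTheory

noncomputable section

/-- A Feynman graph with vertices `Fin nV`, edges `Fin nE` (each edge has two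
distinct endpoints, multiple edges allowed), a set of external vertices and
real edge weights. -/
structure FeynmanGraph (nV nE : ℕ) where
  ends : Fin nE → Fin nV × Fin nV
  ends_ne : ∀ e, (ends e).1 ≠ (ends e).2
  ext : Finset (Fin nV)
  ν : Fin nE → ℝ

/-- `λ = d/2 - 1`. -/
def lam (d : ℕ) : ℝ := (d : ℝ) / 2 - 1

namespace FeynmanGraph

variable {nV nE : ℕ} (G : FeynmanGraph nV nE)

/-- The edge `e` is incident to the vertex `v`. -/
def Incident (e : Fin nE) (v : Fin nV) : Prop :=
  (G.ends e).1 = v ∨ (G.ends e).2 = v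

/-- The edge `e` joins the vertices `u` and `v`. -/
def Joins (e : Fin nE) (u v : Fin nV) : Prop :=
  G.ends e = (u, v) ∨ G.ends e = (v, u)

/-- The internal vertices of `G`. -/
def intVerts : Finset (Fin nV) := Finset.univ.filter (fun v => v ∉ G.ext)

/-- The simple graph on the vertices of `G` induced by a subset `F` of the edges. -/
def edgeGraph (F : Finset (Fin nE)) : SimpleGraph (Fin nV) :=
  SimpleGraph.fromRel (fun u v => ∃ e ∈ F, G.Joins e u v)

/-- `F` is a spanning forest of `G` compatible with the collection `p` of pairwise
disjoint vertex sets: `F` is acyclic (as a set of multigraph edges), the graph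
`(V, F)` has exactly `p.card` connected components, and distinct parts of `p` lie in
distinct components.  (Acyclicity together with the component count is expressed by
the edge count `F.card + p.card = nV`.) -/
def IsForest (p : Finset (Finset (Fin nV))) (F : Finset (Fin nE)) : Prop :=
  F.card + p.card = nV ∧
  Nat.card (G.edgeGraph F).ConnectedComponent = p.card ∧
  (∀ P ∈ p, ∀ u ∈ P, ∀ v ∈ P, (G.edgeGraph F).Reachable u v) ∧
  (∀ P ∈ p, ∀ Q ∈ p, P ≠ Q → ∀ u ∈ P, ∀ v ∈ Q, ¬ (G.edgeGraph F).Reachable u v)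

/-- The set `𝓕_G^p` of spanning forests compatible with `p`. -/
def forests (p : Finset (Finset (Fin nV))) : Finset (Finset (Fin nE)) :=
  Finset.univ.filter (fun F => G.IsForest p F)

/-- The dual spanning forest polynomial `Ψ̃_G^p`, evaluated at `α`. -/
def dualForestPoly (p : Finset (Finset (Fin nV))) (α : Fin nE → ℝ) : ℝ :=
  ∑ F ∈ G.forests p, ∏ e ∈ F, α e

/-- The spanning forest polynomial `Ψ_G^p`, evaluated at `α`. -/
def forestPoly (p : Finset (Finset (Fin nV))) (α : Fin nE → ℝ) : ℝ :=
  ∑ F ∈ G.forests p, ∏ e ∈ Finset.univ \ F, α e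

/-- The partition of the external vertices into singletons. -/
def singlePart : Finset (Finset (Fin nV)) := G.ext.image (fun v => {v})

/-- The collection `p(i,j)` consisting of `{i, j}` together with the singletons of the
remaining external vertices. -/
def pairPart (i j : Fin nV) : Finset (Finset (Fin nV)) :=
  insert ({i, j} : Finset (Fin nV)) (((G.ext.erase i).erase j).image (fun v => {v}))

/-- `Ψ̃_G`, evaluated at `α`. -/
def psiTilde (α : Fin nE → ℝ) : ℝ := G.dualForestPoly G.singlePart α

/-- `Φ̃_G(α, x) = Σ_{i<j external} ‖x_i - x_j‖² Ψ̃_G^{p(i,j)}(α)`. -/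
def phiTilde {d : ℕ} (x : Fin nV → EuclideanSpace ℝ (Fin d)) (α : Fin nE → ℝ) : ℝ :=
  ∑ i ∈ G.ext, ∑ j ∈ G.ext.filter (fun j => i < j),
    ‖x i - x j‖ ^ 2 * G.dualForestPoly (G.pairPart i j) α

/-- Positions of all vertices: external vertices are placed according to `x`,
internal vertices according to `y`. -/
def assemble {E : Type*} (x : Fin nV → E) (y : {v : Fin nV // v ∉ G.ext} → E) :
    Fin nV → E :=
  fun v => if h : v ∉ G.ext then y ⟨v, h⟩ else x v

/-- The position space Feynman integral
`f_G(x) = ∫ ∏_{v internal} d^d x_v/π^{d/2} ∏_e ‖x_{u(e)} - x_{w(e)}‖^{-2λν_e}`,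
a Lebesgue integral of a nonnegative function, with values in `[0,∞]`.  Only the
external components of `x` matter. -/
def posIntegral (d : ℕ) (x : Fin nV → EuclideanSpace ℝ (Fin d)) : ℝ≥0∞ :=
  (∫⁻ y : {v : Fin nV // v ∉ G.ext} → EuclideanSpace ℝ (Fin d),
      ENNReal.ofReal (∏ e,
        ‖G.assemble x y (G.ends e).1 - G.assemble x y (G.ends e).2‖ ^ (-(2 * lam d * G.ν e)))) /
    ENNReal.ofReal (Real.pi ^ ((d : ℝ) / 2 * (G.intVerts.card : ℝ)))

/-- The standard positions of the three external vertices `0`, `1`, `z`. -/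
def extPos (d : ℕ) (v0 v1 vz : Fin nV) (z : ℂ) : Fin nV → EuclideanSpace ℝ (Fin d) :=
  fun v =>
    if v = v0 then 0
    else if v = v1 then WithLp.toLp 2 (fun i : Fin d => if (i : ℕ) = 0 then 1 else 0)
    else if v = vz then
      WithLp.toLp 2 (fun i : Fin d => if (i : ℕ) = 0 then z.re else if (i : ℕ) = 1 then z.im else 0)
    else 0

/-- The graphical function `f_G(z)` of a graph with the three external vertices
`v0`, `v1`, `vz`. -/
def graphicalFn (d : ℕ) (v0 v1 vz : Fin nV) (z : ℂ) : ℝ≥0∞ :=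
  G.posIntegral d (extPos d v0 v1 vz z)

/-- The edges of `G` having both endpoints in `Vg`. -/
def edgesWithin (Vg : Finset (Fin nV)) : Finset (Fin nE) :=
  Finset.univ.filter (fun e => (G.ends e).1 ∈ Vg ∧ (G.ends e).2 ∈ Vg)

/-- Ultraviolet convergence. -/
def UVConvergent (d : ℕ) : Prop :=
  ∀ Vg : Finset (Fin nV), 2 ≤ Vg.card → (Vg ∩ G.ext).card ≤ 1 →
    lam d * ∑ e ∈ G.edgesWithin Vg, G.ν e < (d : ℝ) / 2 * ((Vg.card : ℝ) - 1)

/-- `(Vg, Eg)` is a subgraph of `G`. -/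
def IsSubgraph (Vg : Finset (Fin nV)) (Eg : Finset (Fin nE)) : Prop :=
  ∀ e ∈ Eg, (G.ends e).1 ∈ Vg ∧ (G.ends e).2 ∈ Vg

/-- `v` is a `g`-internal vertex of the subgraph `g = (Vg, Eg)`. -/
def GInternal (Vg : Finset (Fin nV)) (Eg : Finset (Fin nE)) (v : Fin nV) : Prop :=
  v ∉ G.ext ∧ v ∈ Vg ∧ ∀ e, G.Incident e v → e ∈ Eg

/-- The set of `g`-internal vertices of the subgraph `g = (Vg, Eg)`. -/
def gInternalSet (Vg : Finset (Fin nV)) (Eg : Finset (Fin nE)) : Finset (Fin nV) :=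
  Finset.univ.filter (fun v => G.GInternal Vg Eg v)

/-- Infrared convergence. -/
def IRConvergent (d : ℕ) : Prop :=
  ∀ Vg : Finset (Fin nV), ∀ Eg : Finset (Fin nE), G.IsSubgraph Vg Eg →
    0 < (G.gInternalSet Vg Eg).card →
    (∀ e ∈ Eg, G.GInternal Vg Eg (G.ends e).1 ∨ G.GInternal Vg Eg (G.ends e).2) →
    (d : ℝ) / 2 * ((G.gInternalSet Vg Eg).card : ℝ) < lam d * ∑ e ∈ Eg, G.ν e

/-- The superficial degree of divergence `M_G = λ ν_G - (d/2)·V_int`. -/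
def Mdeg (d : ℕ) : ℝ := lam d * ∑ e, G.ν e - (d : ℝ) / 2 * (G.intVerts.card : ℝ)

end FeynmanGraph

namespace FeynmanGraph

variable {nV nE : ℕ} (G : FeynmanGraph nV nE)

/-- The dual spanning forest polynomial `Ψ̃_G^p` as a multivariate polynomial over `ℤ`
in the variables `α_e`, `e ∈ E`. -/
def dualPoly (p : Finset (Finset (Fin nV))) : MvPolynomial (Fin nE) ℤ :=
  ∑ F ∈ G.forests p, ∏ e ∈ F, MvPolynomial.X e

/-- The endpoint of the edge `e` other than `k` (for `e` incident to `k`). -/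
def other (e : Fin nE) (k : Fin nV) : Fin nV :=
  if (G.ends e).1 = k then (G.ends e).2 else (G.ends e).1

/-- The collection `q(v,w)` consisting of the part `{v, w}` (a singleton if `v = w`)
together with the singletons of all external vertices. -/
def qPart (v w : Fin nV) : Finset (Finset (Fin nV)) :=
  insert ({v, w} : Finset (Fin nV)) (G.ext.image (fun m => {m}))

end FeynmanGraph

namespace FeynmanGraph

/-- The collection `r(k,w)` consisting of the part `{k, w}` together with the
singletons of all external vertices other than `k`. -/
def rPart {nV nE : ℕ} (G : FeynmanGraph nV nE) (k w : Fin nV) : Finset (Finset (Fin nV)) :=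
  insert ({k, w} : Finset (Fin nV)) ((G.ext.erase k).image (fun m => {m}))

end FeynmanGraph

namespace FeynmanGraph

variable {nV nE : ℕ} (G : FeynmanGraph nV nE)

theorem Joins.symm {G : FeynmanGraph nV nE} {e : Fin nE} {u v : Fin nV} (h : G.Joins e u v) :
    G.Joins e v u := Or.symm h

theorem Joins.ne {G : FeynmanGraph nV nE} {e : Fin nE} {u v : Fin nV} (h : G.Joins e u v) :
    u ≠ v := by
  have := G.ends_ne e
  rcases h with h | h <;> rw [h] at this
  · exact this
  · exact this.symm

theorem Joins.incident {G : FeynmanGraph nV nE} {e : Fin nE} {u v : Fin nV}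
    (h : G.Joins e u v) : G.Incident e u := by
  rcases h with h | h <;> simp [Incident, h]

theorem Joins.other_eq {G : FeynmanGraph nV nE} {e : Fin nE} {u v : Fin nV}
    (h : G.Joins e u v) : G.other e u = v := by
  have hne := h.ne
  rcases h with h | h <;> simp [other, h]
  intro h'
  exact absurd h'.symm hne

theorem Incident.joins_other {G : FeynmanGraph nV nE} {e : Fin nE} {k : Fin nV}
    (h : G.Incident e k) : G.Joins e k (G.other e k) := by
  unfold other
  split_ifs with h1
  · exact Or.inl (Prod.ext h1 rfl)
  · exact Or.inr (Prod.ext rfl (h.resolve_left h1))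

theorem edgeGraph_adj {F : Finset (Fin nE)} {u v : Fin nV} :
    (G.edgeGraph F).Adj u v ↔ ∃ e ∈ F, G.Joins e u v := by
  simp only [edgeGraph, SimpleGraph.fromRel_adj]
  constructor
  · rintro ⟨-, ⟨e, he, h⟩ | ⟨e, he, h⟩⟩
    · exact ⟨e, he, h⟩
    · exact ⟨e, he, h.symm⟩
  · rintro ⟨e, he, h⟩
    exact ⟨h.ne, Or.inl ⟨e, he, h⟩⟩

theorem edgeGraph_mono {F F' : Finset (Fin nE)} (h : F ⊆ F') :
    G.edgeGraph F ≤ G.edgeGraph F' := by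
  intro u v huv
  rw [edgeGraph_adj] at huv ⊢
  obtain ⟨e, he, h'⟩ := huv
  exact ⟨e, h he, h'⟩

theorem reachable_of_joins {F : Finset (Fin nE)} {f : Fin nE} {a b : Fin nV} (hf : f ∈ F)
    (h : G.Joins f a b) : (G.edgeGraph F).Reachable a b :=
  SimpleGraph.Adj.reachable ((G.edgeGraph_adj).2 ⟨f, hf, h⟩)

theorem Joins.endpoints_eq {G : FeynmanGraph nV nE} {e : Fin nE} {a b u v : Fin nV}
    (h : G.Joins e a b) (h' : G.Joins e u v) : (u = a ∧ v = b) ∨ (u = b ∧ v = a) := by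
  unfold Joins at h h'
  grind

/-- Reachability after inserting an edge `f` joining `a` and `b`. -/
theorem reachable_insert {F : Finset (Fin nE)} {f : Fin nE} {a b : Fin nV}
    (h : G.Joins f a b) (u v : Fin nV) :
    (G.edgeGraph (insert f F)).Reachable u v ↔
      (G.edgeGraph F).Reachable u v ∨
      ((G.edgeGraph F).Reachable u a ∧ (G.edgeGraph F).Reachable b v) ∨
      ((G.edgeGraph F).Reachable u b ∧ (G.edgeGraph F).Reachable a v) := by
  have hle := G.edgeGraph_mono (Finset.subset_insert f F)
  have hab := G.reachable_of_joins (Finset.mem_insert_self f F) h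
  constructor
  · rintro ⟨p⟩
    induction p with
    | nil => exact Or.inl (SimpleGraph.Reachable.refl _)
    | @cons x y z hadj p ih =>
      obtain ⟨e, he, hxy⟩ := (G.edgeGraph_adj).1 hadj
      rcases Finset.mem_insert.1 he with rfl | he
      · rcases h.endpoints_eq hxy with ⟨rfl, rfl⟩ | ⟨rfl, rfl⟩
        · rcases ih with ih | ⟨-, ih⟩ | ⟨-, ih⟩
          · exact Or.inr (Or.inl ⟨SimpleGraph.Reachable.refl _, ih⟩)
          · exact Or.inr (Or.inl ⟨SimpleGraph.Reachable.refl _, ih⟩)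
          · exact Or.inl ih
        · rcases ih with ih | ⟨-, ih⟩ | ⟨-, ih⟩
          · exact Or.inr (Or.inr ⟨SimpleGraph.Reachable.refl _, ih⟩)
          · exact Or.inl ih
          · exact Or.inr (Or.inr ⟨SimpleGraph.Reachable.refl _, ih⟩)
      · have hr := G.reachable_of_joins he hxy
        rcases ih with ih | ⟨ih, ih'⟩ | ⟨ih, ih'⟩
        · exact Or.inl (hr.trans ih)
        · exact Or.inr (Or.inl ⟨hr.trans ih, ih'⟩)
        · exact Or.inr (Or.inr ⟨hr.trans ih, ih'⟩)
  · rintro (h1 | ⟨h1, h2⟩ | ⟨h1, h2⟩)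
    · exact h1.mono hle
    · exact (h1.mono hle).trans (hab.trans (h2.mono hle))
    · exact (h1.mono hle).trans (hab.symm.trans (h2.mono hle))

theorem card_component_insert_of_reachable {F : Finset (Fin nE)} {f : Fin nE} {a b : Fin nV}
    (h : G.Joins f a b) (hr : (G.edgeGraph F).Reachable a b) :
    Nat.card (G.edgeGraph (insert f F)).ConnectedComponent =
      Nat.card (G.edgeGraph F).ConnectedComponent := by
  refine Nat.card_congr (Quot.congrRight fun u v => ?_)
  rw [G.reachable_insert h]
  constructor
  · rintro (h1 | ⟨h1, h2⟩ | ⟨h1, h2⟩)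
    · exact h1
    · exact h1.trans (hr.trans h2)
    · exact h1.trans (hr.symm.trans h2)
  · exact Or.inl

theorem card_component_insert_of_not_reachable {F : Finset (Fin nE)} {f : Fin nE} {a b : Fin nV}
    (h : G.Joins f a b) (hr : ¬ (G.edgeGraph F).Reachable a b) :
    Nat.card (G.edgeGraph (insert f F)).ConnectedComponent + 1 =
      Nat.card (G.edgeGraph F).ConnectedComponent := by
  have hle := G.edgeGraph_mono (Finset.subset_insert f F)
  let cb := (G.edgeGraph F).connectedComponentMk b
  let φ : {c : (G.edgeGraph F).ConnectedComponent // c ≠ cb} →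
      (G.edgeGraph (insert f F)).ConnectedComponent :=
    fun c => c.1.map (SimpleGraph.Hom.ofLE hle)
  have hφ : Function.Bijective φ := by
    constructor
    · rintro ⟨c, hc⟩ ⟨d, hd⟩ hcd
      induction c using SimpleGraph.ConnectedComponent.ind with | _ u
      induction d using SimpleGraph.ConnectedComponent.ind with | _ v
      have huv : (G.edgeGraph (insert f F)).Reachable u v :=
        SimpleGraph.ConnectedComponent.exact hcd
      have hc' : ¬ (G.edgeGraph F).Reachable u b :=
        fun h' => hc (SimpleGraph.ConnectedComponent.sound h')
      have hd' : ¬ (G.edgeGraph F).Reachable v b :=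
        fun h' => hd (SimpleGraph.ConnectedComponent.sound h')
      rcases (G.reachable_insert h u v).1 huv with h1 | ⟨-, h2⟩ | ⟨h1, -⟩
      · exact Subtype.ext (SimpleGraph.ConnectedComponent.sound h1)
      · exact absurd h2.symm hd'
      · exact absurd h1 hc'
    · intro c
      induction c using SimpleGraph.ConnectedComponent.ind with | _ v
      by_cases hv : (G.edgeGraph F).Reachable v b
      · refine ⟨⟨(G.edgeGraph F).connectedComponentMk a,
          fun h' => hr (SimpleGraph.ConnectedComponent.exact h')⟩, ?_⟩
        exact SimpleGraph.ConnectedComponent.sound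
          ((G.reachable_insert h a v).2
            (Or.inr (Or.inl ⟨SimpleGraph.Reachable.refl _, hv.symm⟩)))
      · exact ⟨⟨(G.edgeGraph F).connectedComponentMk v,
          fun h' => hv (SimpleGraph.ConnectedComponent.exact h')⟩, rfl⟩
  rw [← Nat.card_eq_of_bijective φ hφ, Nat.card_eq_fintype_card, Nat.card_eq_fintype_card,
    Fintype.card_subtype_compl, Fintype.card_subtype_eq]
  have : 0 < Fintype.card (G.edgeGraph F).ConnectedComponent := Fintype.card_pos_iff.2 ⟨cb⟩
  omega

theorem le_card_component_add_card (F : Finset (Fin nE)) :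
    nV ≤ Nat.card (G.edgeGraph F).ConnectedComponent + F.card := by
  induction F using Finset.induction_on with
  | empty =>
    have hinj : Function.Injective (G.edgeGraph ∅).connectedComponentMk := by
      intro u v huv
      obtain ⟨p⟩ := SimpleGraph.ConnectedComponent.exact huv
      cases p with
      | nil => rfl
      | cons h _ => simp [edgeGraph_adj] at h
    simpa using Nat.card_le_card_of_injective _ hinj
  | @insert f F hf ih =>
    have h : G.Joins f (G.ends f).1 (G.ends f).2 := Or.inl rfl
    rw [Finset.card_insert_of_notMem hf]
    by_cases hr : (G.edgeGraph F).Reachable (G.ends f).1 (G.ends f).2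
    · have := G.card_component_insert_of_reachable h hr
      omega
    · have := G.card_component_insert_of_not_reachable h hr
      omega

theorem reachable_erase_of_walk {F : Finset (Fin nE)} {f : Fin nE} {k : Fin nV}
    (hf : G.Incident f k) {u v : Fin nV} (p : (G.edgeGraph F).Walk u v) (hp : k ∉ p.support) :
    (G.edgeGraph (F.erase f)).Reachable u v := by
  induction p with
  | nil => exact SimpleGraph.Reachable.refl _
  | @cons x y z hxy p ih =>
    obtain ⟨e, he, hxy⟩ := (G.edgeGraph_adj).1 hxy
    rw [SimpleGraph.Walk.support_cons, List.mem_cons, not_or] at hp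
    refine (G.reachable_of_joins (Finset.mem_erase.2 ⟨?_, he⟩) hxy).trans (ih hp.2)
    rintro rfl
    have hky : k ≠ y := fun h => hp.2 (h ▸ p.start_mem_support)
    rcases hf.joins_other.endpoints_eq hxy with ⟨h, -⟩ | ⟨-, h⟩
    · exact hp.1 h.symm
    · exact hky h.symm

theorem singlePart_card : G.singlePart.card = G.ext.card :=
  Finset.card_image_of_injective _ Finset.singleton_injective

theorem card_insert_pair_image_singleton {a b : Fin nV} (hab : a ≠ b) (s : Finset (Fin nV)) :
    (insert ({a, b} : Finset (Fin nV)) (s.image fun v => ({v} : Finset (Fin nV)))).card = s.card + 1 := by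
  rw [Finset.card_insert_of_notMem, Finset.card_image_of_injective _ Finset.singleton_injective]
  intro h
  obtain ⟨v, -, hv⟩ := Finset.mem_image.1 h
  have := congrArg Finset.card hv
  rw [Finset.card_pair hab] at this
  simp at this

theorem isForest_singlePart_iff {F : Finset (Fin nE)} :
    G.IsForest G.singlePart F ↔ F.card + G.ext.card = nV ∧
      Nat.card (G.edgeGraph F).ConnectedComponent = G.ext.card ∧
      ∀ u ∈ G.ext, ∀ v ∈ G.ext, (G.edgeGraph F).Reachable u v → u = v := by
  unfold IsForest
  rw [singlePart_card]
  simp only [singlePart, Finset.forall_mem_image, Finset.mem_singleton, forall_eq,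
    SimpleGraph.Reachable.refl, implies_true, true_and, ne_eq, Finset.singleton_inj]
  grind

/-- Compatibility with `{a, b}` together with the singletons of `s`. -/
theorem isForest_insert_pair_iff {F : Finset (Fin nE)} {a b : Fin nV} (hab : a ≠ b)
    {s : Finset (Fin nV)} (ha : a ∉ s) :
    G.IsForest (insert ({a, b} : Finset (Fin nV)) (s.image fun v => {v})) F ↔
      F.card + (s.card + 1) = nV ∧
      Nat.card (G.edgeGraph F).ConnectedComponent = s.card + 1 ∧
      (G.edgeGraph F).Reachable a b ∧
      ∀ u ∈ insert a s, ∀ v ∈ insert a s, (G.edgeGraph F).Reachable u v → u = v := by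
  unfold IsForest
  rw [card_insert_pair_image_singleton hab]
  refine and_congr_right fun _ => and_congr_right fun _ => ?_
  constructor
  · rintro ⟨h1, h2⟩
    have hmem : ∀ v ∈ s, ({v} : Finset (Fin nV)) ∈
        insert ({a, b} : Finset (Fin nV)) (s.image fun v => {v}) := fun v hv =>
      Finset.mem_insert_of_mem (Finset.mem_image_of_mem _ hv)
    have hne : ∀ v ∈ s, ({a, b} : Finset (Fin nV)) ≠ {v} := by
      intro v hv h
      have : a ∈ ({v} : Finset (Fin nV)) := h ▸ by simp
      exact ha (Finset.mem_singleton.1 this ▸ hv)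
    refine ⟨h1 _ (Finset.mem_insert_self _ _) a (by simp) b (by simp), ?_⟩
    have key : ∀ v ∈ s, ¬ (G.edgeGraph F).Reachable a v := fun v hv =>
      h2 _ (Finset.mem_insert_self _ _) _ (hmem v hv) (hne v hv) a (by simp) v (by simp)
    intro u hu v hv huv
    rcases Finset.mem_insert.1 hu with rfl | hus <;> rcases Finset.mem_insert.1 hv with rfl | hvs
    · rfl
    · exact absurd huv (key v hvs)
    · exact absurd huv.symm (key u hus)
    · by_contra hne'
      exact h2 _ (hmem u hus) _ (hmem v hvs) (by simpa using hne') u (by simp) v (by simp) huv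
  · rintro ⟨h1, h2⟩
    have key : ∀ v ∈ s, ¬ (G.edgeGraph F).Reachable a v := fun v hv h => by
      have := h2 a (by simp) v (by simp [hv]) h
      exact ha (this ▸ hv)
    have hpair : ∀ u ∈ ({a, b} : Finset (Fin nV)), (G.edgeGraph F).Reachable a u := by
      intro u hu
      simp only [Finset.mem_insert, Finset.mem_singleton] at hu
      rcases hu with rfl | rfl
      · exact SimpleGraph.Reachable.refl _
      · exact h1
    constructor
    · intro P hP u hu v hv
      rcases Finset.mem_insert.1 hP with rfl | hP
      · exact (hpair u hu).symm.trans (hpair v hv)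
      · obtain ⟨x, -, rfl⟩ := Finset.mem_image.1 hP
        rw [Finset.mem_singleton.1 hu, Finset.mem_singleton.1 hv]
    · intro P hP Q hQ hPQ u hu v hv huv
      rcases Finset.mem_insert.1 hP with rfl | hP <;> rcases Finset.mem_insert.1 hQ with rfl | hQ
      · exact hPQ rfl
      · obtain ⟨y, hy, rfl⟩ := Finset.mem_image.1 hQ
        rw [Finset.mem_singleton] at hv
        exact key y hy (hv ▸ (hpair u hu).trans huv)
      · obtain ⟨x, hx, rfl⟩ := Finset.mem_image.1 hP
        rw [Finset.mem_singleton] at hu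
        exact key x hx (hu ▸ (hpair v hv).trans huv.symm)
      · obtain ⟨x, hx, rfl⟩ := Finset.mem_image.1 hP
        obtain ⟨y, hy, rfl⟩ := Finset.mem_image.1 hQ
        rw [Finset.mem_singleton] at hu hv
        subst hu hv
        exact hPQ (by rw [h2 u (by simp [hx]) v (by simp [hy]) huv])

theorem isForest_rPart_iff {F : Finset (Fin nE)} {k w : Fin nV} (hk : k ∈ G.ext)
    (hw : w ∉ G.ext) :
    G.IsForest (G.rPart k w) F ↔
      G.IsForest G.singlePart F ∧ (G.edgeGraph F).Reachable k w := by
  have hkw : k ≠ w := fun h => hw (h ▸ hk)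
  rw [rPart, G.isForest_insert_pair_iff hkw (by simp), isForest_singlePart_iff,
    Finset.insert_erase hk, Finset.card_erase_add_one hk]
  tauto

theorem isForest_pairPart_iff {F : Finset (Fin nE)} {k l : Fin nV} (hk : k ∈ G.ext)
    (hl : l ∈ G.ext) (hlk : l ≠ k) :
    G.IsForest (G.pairPart k l) F ↔
      F.card + G.ext.card = nV + 1 ∧
      Nat.card (G.edgeGraph F).ConnectedComponent + 1 = G.ext.card ∧
      (G.edgeGraph F).Reachable k l ∧
      ∀ u ∈ G.ext.erase l, ∀ v ∈ G.ext.erase l, (G.edgeGraph F).Reachable u v → u = v := by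
  have hc := Finset.card_erase_add_one hl
  have hc' := Finset.card_erase_add_one (Finset.mem_erase.2 ⟨hlk.symm, hk⟩)
  rw [pairPart, G.isForest_insert_pair_iff hlk.symm (by simp),
    Finset.erase_right_comm, Finset.insert_erase (Finset.mem_erase.2 ⟨hlk.symm, hk⟩), hc', ← hc]
  refine and_congr (by omega) (and_congr (by omega) Iff.rfl)

/-- In a forest compatible with the singletons, every vertex is connected to an external one. -/
theorem exists_ext_reachable {F : Finset (Fin nE)} (hF : G.IsForest G.singlePart F)
    (w : Fin nV) : ∃ l ∈ G.ext, (G.edgeGraph F).Reachable w l := by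
  obtain ⟨-, hcard, hsep⟩ := G.isForest_singlePart_iff.1 hF
  have hinj : Function.Injective
      (fun l : G.ext => (G.edgeGraph F).connectedComponentMk l.1) := fun u v huv =>
    Subtype.ext (hsep u u.2 v v.2 (SimpleGraph.ConnectedComponent.exact huv))
  obtain ⟨l, hl⟩ := (hinj.bijective_of_nat_card_le (by rw [hcard]; simp)).2
    ((G.edgeGraph F).connectedComponentMk w)
  exact ⟨l, l.2, (SimpleGraph.ConnectedComponent.exact hl).symm⟩

/-- Adding an edge from `k` to the component of another external vertex `l` merges the two
components. -/
theorem isForest_pairPart_insert {F : Finset (Fin nE)} {f : Fin nE} {k l w : Fin nV}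
    (hk : k ∈ G.ext) (hl : l ∈ G.ext) (hF : G.IsForest G.singlePart F) (hf : G.Joins f k w)
    (hkw : ¬ (G.edgeGraph F).Reachable k w) (hwl : (G.edgeGraph F).Reachable w l) :
    G.IsForest (G.pairPart k l) (insert f F) := by
  have hlk : l ≠ k := by
    rintro rfl
    exact hkw hwl.symm
  obtain ⟨hc, hcc, hsep⟩ := G.isForest_singlePart_iff.1 hF
  have hfF : f ∉ F := fun h => hkw (G.reachable_of_joins h hf)
  refine (G.isForest_pairPart_iff hk hl hlk).2 ⟨?_, ?_, ?_, ?_⟩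
  · rw [Finset.card_insert_of_notMem hfF]
    omega
  · rw [G.card_component_insert_of_not_reachable hf hkw, hcc]
  · exact (G.reachable_insert hf k l).2 (Or.inr (Or.inl ⟨SimpleGraph.Reachable.refl _, hwl⟩))
  · intro u hu v hv huv
    obtain ⟨hul, hu⟩ := Finset.mem_erase.1 hu
    obtain ⟨hvl, hv⟩ := Finset.mem_erase.1 hv
    rcases (G.reachable_insert hf u v).1 huv with h | ⟨-, h⟩ | ⟨h, -⟩
    · exact hsep u hu v hv h
    · exact absurd (hsep v hv l hl (h.symm.trans hwl)) hvl
    · exact absurd (hsep u hu l hl (h.trans hwl)) hul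

/-- In a forest connecting `k` and `l`, deleting the first edge of the path from `k` to `l`
separates the two. -/
theorem exists_erase_isForest_singlePart {F : Finset (Fin nE)} {k l : Fin nV}
    (hk : k ∈ G.ext) (hl : l ∈ G.ext) (hlk : l ≠ k) (hF : G.IsForest (G.pairPart k l) F) :
    ∃ f ∈ F, G.Incident f k ∧ G.IsForest G.singlePart (F.erase f) ∧
      ¬ (G.edgeGraph (F.erase f)).Reachable k (G.other f k) := by
  obtain ⟨hc, hcc, hkl, hsep⟩ := (G.isForest_pairPart_iff hk hl hlk).1 hF
  obtain ⟨p, hp⟩ := hkl.exists_isPath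
  cases p with
  | nil => exact absurd rfl hlk
  | @cons _ w _ hadj p =>
    obtain ⟨f, hfF, hf⟩ := (G.edgeGraph_adj).1 hadj
    rw [SimpleGraph.Walk.cons_isPath_iff] at hp
    have hwl := G.reachable_erase_of_walk hf.incident p hp.2
    have hins := Finset.insert_erase hfF
    have hcard := Finset.card_erase_add_one hfF
    have hkw : ¬ (G.edgeGraph (F.erase f)).Reachable k w := by
      intro h
      have h1 := G.card_component_insert_of_reachable hf h
      have h2 := G.le_card_component_add_card (F.erase f)
      rw [hins] at h1
      omega
    have hcomp := G.card_component_insert_of_not_reachable hf hkw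
    rw [hins] at hcomp
    have hle := G.edgeGraph_mono (Finset.erase_subset f F)
    have key : ∀ v ∈ G.ext, (G.edgeGraph (F.erase f)).Reachable l v → v = l := by
      intro v hv h
      by_contra hvl
      have hkv := hsep k (Finset.mem_erase.2 ⟨hlk.symm, hk⟩) v (Finset.mem_erase.2 ⟨hvl, hv⟩)
        (hkl.trans (h.mono hle))
      subst hkv
      exact hkw (hwl.trans h).symm
    refine ⟨f, hfF, hf.incident, G.isForest_singlePart_iff.2 ⟨by omega, by omega, ?_⟩,
      by rwa [hf.other_eq]⟩
    intro u hu v hv huv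
    by_cases hul : u = l
    · subst hul
      exact (key v hv huv).symm
    by_cases hvl : v = l
    · subst hvl
      exact key u hu huv.symm
    exact hsep u (Finset.mem_erase.2 ⟨hul, hu⟩) v (Finset.mem_erase.2 ⟨hvl, hv⟩) (huv.mono hle)

/-- Two distinct edges at `k` cannot both be critical for the connection from `k` to `l`. -/
theorem eq_of_insert_eq_insert {F F₁ : Finset (Fin nE)} {f f₁ : Fin nE} {k l w w₁ : Fin nV}
    (hf : G.Joins f k w) (hf₁ : G.Joins f₁ k w₁) (h : insert f F = insert f₁ F₁)
    (hkw : ¬ (G.edgeGraph F).Reachable k w)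
    (hwl : (G.edgeGraph F).Reachable w l) (hkl : ¬ (G.edgeGraph F₁).Reachable k l) :
    f = f₁ := by
  by_contra hne
  have hfF : f ∉ F := fun h' => hkw (G.reachable_of_joins h' hf)
  have hf₁F : f₁ ∈ F := by
    have : f₁ ∈ insert f F := h ▸ Finset.mem_insert_self f₁ F₁
    exact (Finset.mem_insert.1 this).resolve_left (Ne.symm hne)
  have hfF₁ : f ∈ F₁ := by
    have : f ∈ insert f₁ F₁ := h ▸ Finset.mem_insert_self f F
    exact (Finset.mem_insert.1 this).resolve_left hne
  have hle := G.edgeGraph_mono (Finset.erase_subset f₁ F)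
  have hsub : F.erase f₁ ⊆ F₁ := by
    intro e he
    obtain ⟨he₁, he⟩ := Finset.mem_erase.1 he
    have : e ∈ insert f₁ F₁ := h ▸ Finset.mem_insert_of_mem he
    exact (Finset.mem_insert.1 this).resolve_left he₁
  have hwl' := hwl
  rw [← Finset.insert_erase hf₁F, G.reachable_insert hf₁] at hwl'
  rcases hwl' with h' | ⟨h', -⟩ | ⟨-, h'⟩
  · exact hkl ((G.reachable_of_joins hfF₁ hf).trans (h'.mono (G.edgeGraph_mono hsub)))
  · exact hkw (h'.mono hle).symm
  · exact hkw ((h'.mono hle).trans hwl.symm)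

/-- Cutting the first edge on the path from `k` identifies forests joining `k` to some other
external vertex with pairs of a forest and an edge leaving the component of `k`. -/
theorem sum_dualPoly_pairPart (k : Fin nV) (hk : k ∈ G.ext) :
    ∑ l ∈ G.ext.erase k, G.dualPoly (G.pairPart k l) =
      ∑ x ∈ (G.forests G.singlePart ×ˢ Finset.univ.filter (fun f => G.Incident f k)).filter
        (fun x => ¬ (G.edgeGraph x.1).Reachable k (G.other x.2 k)),
        (∏ e ∈ x.1, MvPolynomial.X e) * MvPolynomial.X x.2 := by
  unfold dualPoly
  rw [← Finset.sum_biUnion]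
  swap
  · intro l hl l₁ hl₁ hne
    obtain ⟨hlk, hl⟩ := Finset.mem_erase.1 hl
    obtain ⟨hlk₁, hl₁⟩ := Finset.mem_erase.1 hl₁
    refine Finset.disjoint_left.2 fun F hF hF₁ => hne ?_
    obtain ⟨-, -, -, hsep⟩ :=
      (G.isForest_pairPart_iff hk hl hlk).1 (Finset.mem_filter.1 hF).2
    obtain ⟨-, -, hr, -⟩ :=
      (G.isForest_pairPart_iff hk hl₁ hlk₁).1 (Finset.mem_filter.1 hF₁).2
    by_contra hne'
    exact hlk₁ (hsep k (Finset.mem_erase.2 ⟨hlk.symm, hk⟩) l₁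
      (Finset.mem_erase.2 ⟨Ne.symm hne', hl₁⟩) hr).symm
  symm
  refine Finset.sum_bij (fun x _ => insert x.2 x.1) ?_ ?_ ?_ ?_
  · rintro ⟨F, f⟩ hx
    simp only [forests, Finset.mem_filter, Finset.mem_product, Finset.mem_univ, true_and] at hx
    obtain ⟨⟨hF, hf⟩, hr⟩ := hx
    obtain ⟨l, hl, hwl⟩ := G.exists_ext_reachable hF (G.other f k)
    refine Finset.mem_biUnion.2 ⟨l, Finset.mem_erase.2 ⟨?_, hl⟩, Finset.mem_filter.2
      ⟨Finset.mem_univ _, G.isForest_pairPart_insert hk hl hF hf.joins_other hr hwl⟩⟩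
    rintro rfl
    exact hr hwl.symm
  · rintro ⟨F, f⟩ hx ⟨F₁, f₁⟩ hx₁ h
    simp only [forests, Finset.mem_filter, Finset.mem_product, Finset.mem_univ, true_and]
      at hx hx₁ h
    obtain ⟨⟨hF, hf⟩, hr⟩ := hx
    obtain ⟨⟨hF₁, hf₁⟩, hr₁⟩ := hx₁
    obtain ⟨l, hl, hwl⟩ := G.exists_ext_reachable hF (G.other f k)
    have hkl : ¬ (G.edgeGraph F₁).Reachable k l := by
      intro h'
      have := (G.isForest_singlePart_iff.1 hF₁).2.2 k hk l hl h'
      subst this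
      exact hr hwl.symm
    have hff := G.eq_of_insert_eq_insert hf.joins_other hf₁.joins_other h hr hwl hkl
    subst hff
    have hfF : f ∉ F := fun h' => hr (G.reachable_of_joins h' hf.joins_other)
    have hfF₁ : f ∉ F₁ := fun h' => hr₁ (G.reachable_of_joins h' hf.joins_other)
    rw [← Finset.erase_insert hfF, h, Finset.erase_insert hfF₁]
  · intro F hF
    obtain ⟨l, hl, hF⟩ := Finset.mem_biUnion.1 hF
    obtain ⟨hlk, hl⟩ := Finset.mem_erase.1 hl
    obtain ⟨f, hfF, hf, hs, hr⟩ :=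
      G.exists_erase_isForest_singlePart hk hl hlk (Finset.mem_filter.1 hF).2
    refine ⟨(F.erase f, f), ?_, Finset.insert_erase hfF⟩
    simp only [forests, Finset.mem_filter, Finset.mem_product, Finset.mem_univ, true_and]
    exact ⟨⟨hs, hf⟩, hr⟩
  · rintro ⟨F, f⟩ hx
    simp only [Finset.mem_filter, Finset.mem_product, Finset.mem_univ, true_and] at hx
    have hfF : f ∉ F := fun h => hx.2 (G.reachable_of_joins h hx.1.2.joins_other)
    rw [Finset.prod_insert hfF, mul_comm]

theorem sum_X_mul_dualPoly_rPart (k : Fin nV) (hk : k ∈ G.ext) :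
    ∑ f ∈ Finset.univ.filter (fun f => G.Incident f k ∧ G.other f k ∉ G.ext),
      MvPolynomial.X f * G.dualPoly (G.rPart k (G.other f k)) =
      ∑ x ∈ (G.forests G.singlePart ×ˢ Finset.univ.filter (fun f => G.Incident f k)).filter
        (fun x => (G.edgeGraph x.1).Reachable k (G.other x.2 k)),
        (∏ e ∈ x.1, MvPolynomial.X e) * MvPolynomial.X x.2 := by
  rw [Finset.sum_filter, Finset.sum_filter, Finset.sum_product_right, Finset.sum_filter]
  refine Finset.sum_congr rfl fun f _ => ?_
  by_cases hf : G.Incident f k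
  · by_cases hw : G.other f k ∈ G.ext
    · rw [if_neg (by tauto), if_pos hf]
      refine (Finset.sum_eq_zero fun F hF => if_neg fun hr => ?_).symm
      exact hf.joins_other.ne
        ((G.isForest_singlePart_iff.1 (Finset.mem_filter.1 hF).2).2.2 k hk _ hw hr)
    · rw [if_pos ⟨hf, hw⟩, if_pos hf, dualPoly, ← Finset.sum_filter, Finset.mul_sum]
      refine Finset.sum_congr ?_ fun F _ => mul_comm _ _
      ext F
      simp [forests, G.isForest_rPart_iff hk hw]
  · rw [if_neg (by tauto), if_neg hf]

end FeynmanGraph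

/-- Diagonal forest-polynomial identity.  For an external vertex `k`,
in `ℤ[α_e : e ∈ E]` one has
`Σ_f α_f Ψ̃_G^{r(k,w)} = Ψ̃_G · Σ_{f incident to k} α_f - Σ_{ℓ' ≠ k external} Ψ̃_G^{p(k,ℓ')}`,
where on the left `f` runs over the edges joining `k` to an internal vertex `w`. -/
theorem diagonal_forest_identity {nV nE : ℕ} (G : FeynmanGraph nV nE)
    (k : Fin nV) (hk : k ∈ G.ext) :
    ∑ f ∈ Finset.univ.filter (fun f => G.Incident f k ∧ G.other f k ∉ G.ext),
      MvPolynomial.X f * G.dualPoly (G.rPart k (G.other f k))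
      = G.dualPoly G.singlePart *
          (∑ f ∈ Finset.univ.filter (fun f => G.Incident f k), MvPolynomial.X f) -
        ∑ l' ∈ G.ext.erase k, G.dualPoly (G.pairPart k l') := by
  rw [G.sum_X_mul_dualPoly_rPart k hk, G.sum_dualPoly_pairPart k hk, eq_sub_iff_add_eq,
    Finset.sum_filter_add_sum_filter_not, FeynmanGraph.dualPoly, Finset.sum_mul_sum,
    Finset.sum_product]
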